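/- Let λ and μ be partitions and let n be an integer with n ≥ ℓ(λ) and n ≥ ℓ(μ). Then there exist unique integers c^ν_{λμ}, indexed by the partitions ν with |ν| = |λ| + |μ| and ℓ(ν) ≤ n, such that s_λ(x_1,…,x_n) · s_μ(x_1,…,x_n) = Σ_ν c^ν_{λμ} s_ν(x_1,…,x_n); moreover every coefficient c^ν_{λμ} is non-negative. -/

import Mathlib

open MvPolynomial
open scoped Classical

/-- A partition: a weakly decreasing sequence of non-negative integers
with finitely many nonzero parts (indexed from 0). -/
structure Partn where
  parts : ℕ → ℕ
  antitone : ∀ i j, i ≤ j → parts j ≤ parts i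
  eventually_zero : ∃ N, ∀ i, N ≤ i → parts i = 0

namespace Partn

/-- The weight `|λ|` of a partition: the sum of its parts. -/
noncomputable def weight (p : Partn) : ℕ := ∑ᶠ i, p.parts i

/-- `ℓ(λ) ≤ n`: all parts from index `n` on vanish. -/
def LengthLE (p : Partn) (n : ℕ) : Prop := ∀ i, n ≤ i → p.parts i = 0

/-- The parts of the conjugate partition `λ'`:
`λ'_i` is the number of indices `j` with `λ_j > i`. -/
noncomputable def conjParts (p : Partn) (i : ℕ) : ℕ := Nat.card {j : ℕ // i < p.parts j}

end Partn

/-- The alternant `det(x_i^{l_j + n - j})_{1 ≤ i,j ≤ n}` (indices taken 0-based). -/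
noncomputable def alternant (n : ℕ) (l : ℕ → ℕ) : MvPolynomial (Fin n) ℤ :=
  (Matrix.of fun i j : Fin n =>
    (X i : MvPolynomial (Fin n) ℤ) ^ (l (j : ℕ) + (n - 1 - (j : ℕ)))).det

/-- The Vandermonde determinant `det(x_i^{n-j})_{1 ≤ i,j ≤ n}` (0-based). -/
noncomputable def vandermondeP (n : ℕ) : MvPolynomial (Fin n) ℤ :=
  (Matrix.of fun i j : Fin n =>
    (X i : MvPolynomial (Fin n) ℤ) ^ (n - 1 - (j : ℕ))).det

/-- The Schur polynomial `s_l(x_1,…,x_n)`: the (unique, since `ℤ[x]` is a domain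
and the Vandermonde determinant is nonzero) quotient of the alternant by the
Vandermonde determinant, when the latter divides the former. -/
noncomputable def schur (n : ℕ) (l : ℕ → ℕ) : MvPolynomial (Fin n) ℤ :=
  if h : ∃ q : MvPolynomial (Fin n) ℤ, q * vandermondeP n = alternant n l then h.choose else 0

/-- The Littlewood–Richardson coefficient `c^ν_{λμ}`: the coefficient of `s_ν` in the
Schur-basis expansion of `s_λ · s_μ` in `|λ| + |μ|` variables, extracted as the
coefficient of the dominant monomial `x^{ν+ρ}` in `s_λ · s_μ · (Vandermonde)`.
It is zero unless `|ν| = |λ| + |μ|`. -/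
noncomputable def lrCoeff (l m ν : Partn) : ℤ :=
  if ν.weight = l.weight + m.weight then
    MvPolynomial.coeff
      (Finsupp.equivFunOnFinite.symm fun j : Fin (l.weight + m.weight) =>
        ν.parts (j : ℕ) + (l.weight + m.weight - 1 - (j : ℕ)))
      (schur (l.weight + m.weight) l.parts * schur (l.weight + m.weight) m.parts *
        vandermondeP (l.weight + m.weight))
  else 0


/-- Gelfand-Tsetlin patterns with top row `μ`. -/
structure IsGT (n : ℕ) (μ : ℕ → ℕ) (g : ℕ → ℕ → ℕ) : Prop where
  zero : ∀ r, g 0 r = 0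
  le : ∀ k r, g k r ≤ g (k+1) r
  ge : ∀ k r, g (k+1) (r+1) ≤ g k r
  top : ∀ k, n ≤ k → g k = μ

namespace IsGT

variable {n : ℕ} {μ : ℕ → ℕ} {g : ℕ → ℕ → ℕ}

theorem mono (h : IsGT n μ g) (r : ℕ) : Monotone fun k => g k r :=
  monotone_nat_of_le_succ fun k => h.le k r

theorem anti (h : IsGT n μ g) (k : ℕ) : Antitone (g k) :=
  antitone_nat_of_succ_le fun r => (h.le k (r+1)).trans (h.ge k r)

theorem le_top (h : IsGT n μ g) (k r : ℕ) : g k r ≤ μ r := by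
  have := h.mono r (le_max_left k n)
  simp only [h.top _ (le_max_right k n)] at this
  exact this

theorem eq_zero (h : IsGT n μ g) : ∀ k r, k ≤ r → g k r = 0 := by
  intro k
  induction k with
  | zero => intro r _; exact h.zero r
  | succ k ih =>
    intro r hr
    obtain ⟨s, rfl⟩ : ∃ s, r = s + 1 := ⟨r - 1, by omega⟩
    have := h.ge k s
    have := ih s (by omega)
    omega

theorem eq_zero_n (h : IsGT n μ g) (k r : ℕ) (hr : n ≤ r) : g k r = 0 := by
  have h1 := h.le_top k r
  have h2 := h.eq_zero n r hr
  rw [h.top n le_rfl] at h2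
  omega

theorem le_zero (h : IsGT n μ g) (k r : ℕ) : g k r ≤ μ 0 := by
  have h1 := h.le_top k r
  have h2 := h.anti n (Nat.zero_le r)
  rw [h.top n le_rfl] at h2
  omega

end IsGT

theorem finite_GT (n : ℕ) (μ : ℕ → ℕ) : {g | IsGT n μ g}.Finite := by
  refine Set.Finite.of_injOn (f := fun g (k r : Fin n) => g k r)
    (t := Set.Iic (fun _ _ => μ 0)) ?_ ?_ (Set.finite_Iic _)
  · intro g hg k r
    exact IsGT.le_zero hg k r
  · intro g hg g' hg' he
    funext k r
    by_cases hk : k < n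
    · by_cases hr : r < n
      · exact congrFun (congrFun he ⟨k, hk⟩) ⟨r, hr⟩
      · rw [IsGT.eq_zero_n hg k r (by omega), IsGT.eq_zero_n hg' k r (by omega)]
    · rw [IsGT.top hg k (by omega), IsGT.top hg' k (by omega)]

/-- The finset of patterns. -/
noncomputable def GT (n : ℕ) (μ : ℕ → ℕ) : Finset (ℕ → ℕ → ℕ) := (finite_GT n μ).toFinset

theorem mem_GT {n : ℕ} {μ : ℕ → ℕ} {g : ℕ → ℕ → ℕ} : g ∈ GT n μ ↔ IsGT n μ g := by
  simp [GT]

/-- row of upper bounds coming from the lower row. -/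
def shiftRow (c : ℕ) (d : ℕ → ℕ) : ℕ → ℕ
  | 0 => c
  | r + 1 => min (d r) c

/-- The truncated toggle of level `k+1`, restricted to columns `< c`. -/
def toggle (c k : ℕ) (g : ℕ → ℕ → ℕ) : ℕ → ℕ → ℕ := fun k' r =>
  if k' = k + 1 then
    (if c < g (k+1) r then g (k+1) r else
      min (g (k+2) r) (shiftRow c (g k) r) + max (g (k+2) (r+1)) (g k r) - g (k+1) r)
  else g k' r

theorem toggle_of_ne {c k k' : ℕ} {g : ℕ → ℕ → ℕ} (h : k' ≠ k + 1) :
    toggle c k g k' = g k' := by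
  funext r; simp [toggle, h]

theorem toggle_gt {c k r : ℕ} {g : ℕ → ℕ → ℕ} (h : c < g (k+1) r) :
    toggle c k g (k+1) r = g (k+1) r := by
  simp [toggle, h]

theorem toggle_le {c k r : ℕ} {g : ℕ → ℕ → ℕ} (h : g (k+1) r ≤ c) :
    toggle c k g (k+1) r =
      min (g (k+2) r) (shiftRow c (g k) r) + max (g (k+2) (r+1)) (g k r) - g (k+1) r := by
  simp [toggle, Nat.not_lt.2 h]

theorem shiftRow_bd {n : ℕ} {μ : ℕ → ℕ} {g : ℕ → ℕ → ℕ} (h : IsGT n μ g) (c k r : ℕ)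
    (hc : g (k+1) r ≤ c) :
    g (k+1) r ≤ shiftRow c (g k) r ∧ shiftRow c (g k) r ≤ c := by
  cases r with
  | zero => simp [shiftRow, hc]
  | succ r =>
    have := h.ge k r
    simp only [shiftRow]
    omega

theorem toggle_bd {n : ℕ} {μ : ℕ → ℕ} {g : ℕ → ℕ → ℕ} (h : IsGT n μ g) (c k r : ℕ)
    (hc : g (k+1) r ≤ c) :
    toggle c k g (k+1) r + g (k+1) r =
      min (g (k+2) r) (shiftRow c (g k) r) + max (g (k+2) (r+1)) (g k r) ∧
    max (g (k+2) (r+1)) (g k r) ≤ toggle c k g (k+1) r ∧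
    toggle c k g (k+1) r ≤ min (g (k+2) r) (shiftRow c (g k) r) ∧
    toggle c k g (k+1) r ≤ c := by
  have h1 := shiftRow_bd h c k r hc
  have h2 := h.le k r
  have h3 := h.le (k+1) r
  have h4 := h.ge (k+1) r
  have h5 := toggle_le hc
  simp only [add_assoc] at *
  norm_num at *
  omega

theorem toggle_isGT {n : ℕ} {μ : ℕ → ℕ} {g : ℕ → ℕ → ℕ} (h : IsGT n μ g) (c k : ℕ)
    (hk : k + 1 < n) : IsGT n μ (toggle c k g) := by
  have hb := toggle_bd h c k
  constructor
  · intro r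
    rw [toggle_of_ne (by omega)]
    exact h.zero r
  · intro k' r
    by_cases h1 : k' = k + 1
    · subst h1
      rw [toggle_of_ne (k' := k+1+1) (by omega)]
      by_cases hc : c < g (k+1) r
      · rw [toggle_gt hc]; exact h.le _ _
      · have := hb r (by omega)
        show _ ≤ g (k+2) r
        omega
    · rw [toggle_of_ne h1]
      by_cases h2 : k' = k
      · subst h2
        by_cases hc : c < g (k'+1) r
        · rw [toggle_gt hc]; exact h.le _ _
        · have := hb r (by omega)
          omega
      · rw [toggle_of_ne (by omega)]; exact h.le _ _
  · intro k' r
    by_cases h1 : k' = k + 1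
    · subst h1
      rw [toggle_of_ne (k' := k+1+1) (by omega)]
      by_cases hc : c < g (k+1) r
      · rw [toggle_gt hc]; exact h.ge _ _
      · have := hb r (by omega)
        show g (k+2) (r+1) ≤ _
        omega
    · rw [toggle_of_ne h1]
      by_cases h2 : k' = k
      · subst h2
        by_cases hc : c < g (k'+1) (r+1)
        · rw [toggle_gt hc]; exact h.ge _ _
        · have := hb (r+1) (by omega)
          simp only [shiftRow] at this
          omega
      · rw [toggle_of_ne (by omega)]; exact h.ge _ _
  · intro k' hk'
    rw [toggle_of_ne (by omega)]
    exact h.top k' hk'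

theorem toggle_toggle {n : ℕ} {μ : ℕ → ℕ} {g : ℕ → ℕ → ℕ} (h : IsGT n μ g) (c k : ℕ)
    (hk : k + 1 < n) : toggle c k (toggle c k g) = g := by
  funext k' r
  by_cases h1 : k' = k + 1
  · subst h1
    by_cases hc : c < g (k+1) r
    · rw [toggle_gt (by rw [toggle_gt hc]; exact hc), toggle_gt hc]
    · have h2 := toggle_bd h c k r (by omega)
      have h3 := toggle_bd (toggle_isGT h c k hk) c k r (by omega)
      rw [toggle_of_ne (k' := k) (by omega), toggle_of_ne (k' := k+2) (by omega)] at h3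
      omega
  · rw [toggle_of_ne h1, toggle_of_ne h1]

/-- Number of cells of level `k` in columns `≥ c`. -/
def XS (n : ℕ) (g : ℕ → ℕ → ℕ) (c k : ℕ) : ℕ := ∑ r ∈ Finset.range n, (g k r - c)
/-- Number of cells of level `k` in columns `< c`. -/
def MS (n : ℕ) (g : ℕ → ℕ → ℕ) (c k : ℕ) : ℕ := ∑ r ∈ Finset.range n, min (g k r) c
/-- Number of cells of level `k`. -/
def SS (n : ℕ) (g : ℕ → ℕ → ℕ) (k : ℕ) : ℕ := ∑ r ∈ Finset.range n, g k r
/-- Number of cells of level `k` in column `c`. -/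
def NS (n : ℕ) (g : ℕ → ℕ → ℕ) (c k : ℕ) : ℕ :=
  ∑ r ∈ Finset.range n, if c < g k r then 1 else 0

theorem XS_add_MS (n : ℕ) (g : ℕ → ℕ → ℕ) (c k : ℕ) : XS n g c k + MS n g c k = SS n g k := by
  rw [XS, MS, SS, ← Finset.sum_add_distrib]
  exact Finset.sum_congr rfl fun r _ => by omega

theorem XS_succ (n : ℕ) (g : ℕ → ℕ → ℕ) (c k : ℕ) :
    XS n g c k = XS n g (c+1) k + NS n g c k := by
  rw [XS, XS, NS, ← Finset.sum_add_distrib]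
  exact Finset.sum_congr rfl fun r _ => by split_ifs <;> omega

theorem NS_le {n : ℕ} {μ : ℕ → ℕ} {g : ℕ → ℕ → ℕ} (h : IsGT n μ g) (c k : ℕ) :
    NS n g c k ≤ NS n g c (k+1) := by
  refine Finset.sum_le_sum fun r _ => ?_
  have := h.le k r
  split_ifs <;> omega

theorem NS_ge {n : ℕ} {μ : ℕ → ℕ} {g : ℕ → ℕ → ℕ} (h : IsGT n μ g) (c k : ℕ) :
    NS n g c (k+1) ≤ NS n g c k + 1 := by
  have h1 : NS n g c (k+1) ≤ ∑ r ∈ Finset.range (n+1), if c < g (k+1) r then 1 else 0 := by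
    rw [Finset.sum_range_succ]; exact Nat.le_add_right _ _
  refine h1.trans ?_
  rw [Finset.sum_range_succ']
  refine Nat.add_le_add (Finset.sum_le_sum fun r _ => ?_) (by split_ifs <;> omega)
  have := h.ge k r
  split_ifs <;> omega

theorem XS_toggle {n : ℕ} {μ : ℕ → ℕ} {g : ℕ → ℕ → ℕ} (h : IsGT n μ g) (c k c' k' : ℕ)
    (hc : c ≤ c') : XS n (toggle c k g) c' k' = XS n g c' k' := by
  refine Finset.sum_congr rfl fun r _ => ?_
  by_cases h1 : k' = k + 1
  · subst h1
    by_cases hc : c < g (k+1) r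
    · rw [toggle_gt hc]
    · have := toggle_bd h c k r (by omega)
      omega
  · rw [toggle_of_ne h1]

theorem sum_aux (c : ℕ) (u d : ℕ → ℕ) (N : ℕ) :
    (∑ r ∈ Finset.range N, (min (min (u r) c) (shiftRow c d r) +
      max (min (u (r+1)) c) (min (d r) c))) + min (min (u N) c) (shiftRow c d N) =
    (∑ r ∈ Finset.range N, min (u r) c) + (∑ r ∈ Finset.range N, min (d r) c) + min (u N) c := by
  induction N with
  | zero => simp [shiftRow]
  | succ N ih =>
    simp only [Finset.sum_range_succ, shiftRow] at *
    omega

theorem MS_toggle {n : ℕ} {μ : ℕ → ℕ} {g : ℕ → ℕ → ℕ} (h : IsGT n μ g) (c k : ℕ)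
    (H : ∀ r, c < g (k+1) r → c < g k r) :
    MS n (toggle c k g) c (k+1) + MS n g c (k+1) = MS n g c (k+2) + MS n g c k := by
  have h1 := sum_aux c (g (k+2)) (g k) n
  rw [h.eq_zero_n (k+2) n le_rfl] at h1
  simp only [zero_le, inf_of_le_left, add_zero] at h1
  rw [MS, MS, MS, MS, ← h1, ← Finset.sum_add_distrib]
  refine Finset.sum_congr rfl fun r _ => ?_
  by_cases hc : c < g (k+1) r
  · rw [toggle_gt hc]
    have h2 := H r hc
    have h3 : c < g (k+2) r := hc.trans_le (h.le (k+1) r)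
    have h4 : shiftRow c (g k) r = c := by
      cases r with
      | zero => rfl
      | succ r =>
        have := h.anti k (show r ≤ r + 1 by omega)
        simp only [shiftRow]; omega
    omega
  · have h2 := toggle_bd h c k r (by omega)
    have h3 := shiftRow_bd h c k r (by omega)
    have h4 := h.le k r
    have h5 := h.ge (k+1) r
    have h6 : k + 1 + 1 = k + 2 := rfl
    rw [h6] at h5
    omega

/-- Violation of dominance. -/
def BadAt (n : ℕ) (l : ℕ → ℕ) (g : ℕ → ℕ → ℕ) (c k : ℕ) : Prop :=
  k + 1 < n ∧ l k + 2 * XS n g c (k+1) < l (k+1) + XS n g c (k+2) + XS n g c k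

/-- Littlewood-Richardson condition. -/
def Good (n : ℕ) (l : ℕ → ℕ) (g : ℕ → ℕ → ℕ) : Prop := ∀ c k, ¬ BadAt n l g c k

/-- extremal violation. -/
def IsMaxBad (n : ℕ) (l : ℕ → ℕ) (g : ℕ → ℕ → ℕ) (c k : ℕ) : Prop :=
  BadAt n l g c k ∧ (∀ c' k', c < c' → ¬ BadAt n l g c' k') ∧ ∀ k' < k, ¬ BadAt n l g c k'

theorem IsMaxBad.unique {n : ℕ} {l : ℕ → ℕ} {g : ℕ → ℕ → ℕ} {c k c' k' : ℕ}
    (h : IsMaxBad n l g c k) (h' : IsMaxBad n l g c' k') : c = c' ∧ k = k' := by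
  have hc : c = c' := by
    rcases lt_trichotomy c c' with hh | hh | hh
    · exact absurd h'.1 (h.2.1 _ _ hh)
    · exact hh
    · exact absurd h.1 (h'.2.1 _ _ hh)
  subst hc
  refine ⟨rfl, ?_⟩
  rcases lt_trichotomy k k' with hh | hh | hh
  · exact absurd h.1 (h'.2.2 _ hh)
  · exact hh
  · exact absurd h'.1 (h.2.2 _ hh)

theorem not_badAt_large {n : ℕ} {l μ : ℕ → ℕ} {g : ℕ → ℕ → ℕ} (hl : Antitone l)
    (h : IsGT n μ g) (c k : ℕ) (hc : μ 0 ≤ c) : ¬ BadAt n l g c k := by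
  have h0 : ∀ k, XS n g c k = 0 := by
    intro k
    refine Finset.sum_eq_zero fun r _ => ?_
    have := h.le_zero k r
    omega
  rintro ⟨_, h1⟩
  have := hl (Nat.le_succ k)
  simp only [h0, Nat.succ_eq_add_one] at *
  omega

theorem exists_isMaxBad {n : ℕ} {l μ : ℕ → ℕ} {g : ℕ → ℕ → ℕ} (hl : Antitone l)
    (h : IsGT n μ g) (hb : ¬ Good n l g) : ∃ c k, IsMaxBad n l g c k := by
  simp only [Good, not_forall, not_not] at hb
  obtain ⟨c0, k0, hb⟩ := hb
  have hle : ∀ c k, BadAt n l g c k → c ≤ μ 0 := by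
    intro c k hck
    by_contra hc
    exact not_badAt_large hl h c k (by omega) hck
  let P : ℕ → Prop := fun c => ∃ k, BadAt n l g c k
  have hP : P (Nat.findGreatest P (μ 0)) :=
    Nat.findGreatest_spec (P := P) (hle c0 k0 hb) ⟨k0, hb⟩
  refine ⟨Nat.findGreatest P (μ 0), Nat.find hP, Nat.find_spec hP, ?_, ?_⟩
  · intro c' k' hc' hbad
    exact Nat.findGreatest_is_greatest hc' (hle _ _ hbad) ⟨k', hbad⟩
  · intro k' hk'
    exact Nat.find_min hP hk'

theorem badAt_toggle {n : ℕ} {l μ : ℕ → ℕ} {g : ℕ → ℕ → ℕ} (h : IsGT n μ g) (c k c' k' : ℕ)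
    (hc : c ≤ c') : BadAt n l (toggle c k g) c' k' ↔ BadAt n l g c' k' := by
  simp only [BadAt, XS_toggle h c k c' _ hc]

theorem IsMaxBad.toggle {n : ℕ} {l μ : ℕ → ℕ} {g : ℕ → ℕ → ℕ} (h : IsGT n μ g) {c k : ℕ}
    (hm : IsMaxBad n l g c k) : IsMaxBad n l (toggle c k g) c k := by
  refine ⟨(badAt_toggle h c k c k le_rfl).2 hm.1, ?_, ?_⟩
  · intro c' k' hc'
    rw [badAt_toggle h c k c' k' hc'.le]
    exact hm.2.1 c' k' hc'
  · intro k' hk'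
    rw [badAt_toggle h c k c k' le_rfl]
    exact hm.2.2 k' hk'

theorem IsMaxBad.sums {n : ℕ} {l μ : ℕ → ℕ} {g : ℕ → ℕ → ℕ} (h : IsGT n μ g) {c k : ℕ}
    (hm : IsMaxBad n l g c k) :
    SS n (_root_.toggle c k g) (k+1) + SS n g (k+1) + l k + 1 = SS n g (k+2) + SS n g k + l (k+1) := by
  obtain ⟨hk, h1⟩ := hm.1
  have h2 := hm.2.1 (c+1) k (by omega)
  simp only [BadAt, hk, true_and, not_lt] at h2
  rw [XS_succ n g c, XS_succ n g c, XS_succ n g c] at h1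
  have n1 := NS_le h c k
  have n3 := NS_ge h c (k+1)
  have n5 : k + 1 + 1 = k + 2 := rfl
  rw [n5] at n3
  have hN : NS n g c k = NS n g c (k+1) := by omega
  have H : ∀ r, c < g (k+1) r → c < g k r := by
    intro r hr
    have hrn : r < n := by
      by_contra hrn
      have := h.eq_zero_n (k+1) r (by omega)
      omega
    have := (Finset.sum_eq_sum_iff_of_le (fun r _ => by
      have := h.le k r
      split_ifs <;> omega)).1 hN r (Finset.mem_range.2 hrn)
    simp only [hr, if_true] at this
    by_contra hcon
    simp [hcon] at this
  have hM := MS_toggle h c k H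
  have hX := XS_toggle h c k c (k+1) le_rfl
  have e1 := XS_add_MS n (_root_.toggle c k g) c (k+1)
  have e2 := XS_add_MS n g c (k+1)
  have e3 := XS_add_MS n g c (k+2)
  have e4 := XS_add_MS n g c k
  have x1 := XS_succ n g c (k+1)
  have x2 := XS_succ n g c (k+2)
  have x3 := XS_succ n g c k
  omega

theorem SS_toggle_full {n : ℕ} {μ : ℕ → ℕ} {g : ℕ → ℕ → ℕ} (h : IsGT n μ g) (k : ℕ) (hk : k + 1 < n) :
    SS n (toggle (μ 0) k g) (k+1) + SS n g (k+1) = SS n g (k+2) + SS n g k := by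
  have h' := toggle_isGT h (μ 0) k hk
  have hM := MS_toggle h (μ 0) k (fun r hr => by
    have := h.le_zero (k+1) r
    omega)
  have key : ∀ (g : ℕ → ℕ → ℕ), IsGT n μ g → ∀ k, MS n g (μ 0) k = SS n g k := by
    intro g h k
    refine Finset.sum_congr rfl fun r _ => ?_
    have := h.le_zero k r
    omega
  rwa [key _ h', key _ h, key _ h, key _ h] at hM

theorem SS_mono {n : ℕ} {μ : ℕ → ℕ} {g : ℕ → ℕ → ℕ} (h : IsGT n μ g) (k : ℕ) :
    SS n g k ≤ SS n g (k+1) := Finset.sum_le_sum fun r _ => h.le k r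

theorem SS_toggle_ne {n c k k' : ℕ} {g : ℕ → ℕ → ℕ} (h : k' ≠ k + 1) :
    SS n (toggle c k g) k' = SS n g k' := by
  simp only [SS, toggle_of_ne h]

/-- Weight (content). -/
def wt (n : ℕ) (g : ℕ → ℕ → ℕ) (k : ℕ) : ℕ := SS n g (k+1) - SS n g k

theorem wt_toggle_full {n : ℕ} {μ : ℕ → ℕ} {g : ℕ → ℕ → ℕ} (h : IsGT n μ g) (k : ℕ)
    (hk : k + 1 < n) (i : Fin n) :
    wt n (toggle (μ 0) k g) i =
      wt n g ((Equiv.swap (⟨k, by omega⟩ : Fin n) ⟨k+1, hk⟩ i : Fin n) : ℕ) := by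
  have h1 := SS_toggle_full h k hk
  have m1 := SS_mono h k
  have m2 := SS_mono h (k+1)
  have n5 : k + 1 + 1 = k + 2 := rfl
  by_cases e1 : i = ⟨k, by omega⟩
  · subst e1
    rw [Equiv.swap_apply_left]
    simp only [wt]
    rw [SS_toggle_ne (k' := k) (by omega)]
    rw [n5] at *
    omega
  by_cases e2 : i = ⟨k+1, hk⟩
  · subst e2
    rw [Equiv.swap_apply_right]
    simp only [wt]
    rw [SS_toggle_ne (k' := k+1+1) (by omega)]
    rw [n5] at *
    omega
  rw [Equiv.swap_apply_of_ne_of_ne e1 e2]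
  have e1' : (i : ℕ) ≠ k := fun e => e1 (Fin.ext e)
  have e2' : (i : ℕ) ≠ k + 1 := fun e => e2 (Fin.ext e)
  simp only [wt]
  rw [SS_toggle_ne (by omega), SS_toggle_ne (by omega)]

theorem IsMaxBad.wt {n : ℕ} {l μ : ℕ → ℕ} {g : ℕ → ℕ → ℕ} (h : IsGT n μ g) {c k : ℕ}
    (hm : IsMaxBad n l g c k) (hk : k + 1 < n) (i : Fin n) :
    l i + (n - 1 - i) + wt n (_root_.toggle c k g) i =
      (fun j : Fin n => l j + (n - 1 - j) + _root_.wt n g j)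
        (Equiv.swap (⟨k, by omega⟩ : Fin n) ⟨k+1, hk⟩ i) := by
  have h1 := hm.sums h
  have h' := toggle_isGT h c k hk
  have m1 := SS_mono h k
  have m2 := SS_mono h (k+1)
  have m3 := SS_mono h' k
  have m4 := SS_mono h' (k+1)
  have n5 : k + 1 + 1 = k + 2 := rfl
  rw [SS_toggle_ne (k' := k) (by omega)] at m3
  rw [SS_toggle_ne (k' := k+1+1) (by omega)] at m4
  by_cases e1 : i = ⟨k, by omega⟩
  · subst e1
    rw [Equiv.swap_apply_left]
    simp only [_root_.wt]
    rw [SS_toggle_ne (k' := k) (by omega)]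
    rw [n5] at *
    omega
  by_cases e2 : i = ⟨k+1, hk⟩
  · subst e2
    rw [Equiv.swap_apply_right]
    simp only [_root_.wt]
    rw [SS_toggle_ne (k' := k+1+1) (by omega)]
    rw [n5] at *
    omega
  rw [Equiv.swap_apply_of_ne_of_ne e1 e2]
  have e1' : (i : ℕ) ≠ k := fun e => e1 (Fin.ext e)
  have e2' : (i : ℕ) ≠ k + 1 := fun e => e2 (Fin.ext e)
  simp only [_root_.wt]
  rw [SS_toggle_ne (by omega), SS_toggle_ne (by omega)]

theorem GT_symm_aux {M : Type*} [AddCommMonoid M] (n : ℕ) (μ : ℕ → ℕ) (k : ℕ) (hk : k + 1 < n)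
    (F : (Fin n → ℕ) → M) :
    ∑ g ∈ GT n μ, F (fun i => wt n g (Equiv.swap (⟨k, by omega⟩ : Fin n) ⟨k+1, hk⟩ i : Fin n)) =
      ∑ g ∈ GT n μ, F (fun i => wt n g i) := by
  refine Finset.sum_bij' (fun g _ => toggle (μ 0) k g) (fun g _ => toggle (μ 0) k g) ?_ ?_ ?_ ?_ ?_
  · intro g hg; exact mem_GT.2 (toggle_isGT (mem_GT.1 hg) _ _ hk)
  · intro g hg; exact mem_GT.2 (toggle_isGT (mem_GT.1 hg) _ _ hk)
  · intro g hg; exact toggle_toggle (mem_GT.1 hg) _ _ hk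
  · intro g hg; exact toggle_toggle (mem_GT.1 hg) _ _ hk
  · intro g hg
    congr 1
    funext i
    rw [wt_toggle_full (mem_GT.1 hg) k hk]

theorem GT_symm {M : Type*} [AddCommMonoid M] (n : ℕ) (μ : ℕ → ℕ) (σ : Equiv.Perm (Fin n)) :
    ∀ (F : (Fin n → ℕ) → M),
    ∑ g ∈ GT n μ, F (fun i => wt n g (σ i : Fin n)) = ∑ g ∈ GT n μ, F (fun i => wt n g i) := by
  cases n with
  | zero =>
    intro F
    have : σ = 1 := Subsingleton.elim _ _
    subst this; rfl
  | succ n =>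
    have hσ : σ ∈ Submonoid.closure
        (Set.range fun i : Fin n => Equiv.swap i.castSucc i.succ) := by
      rw [Equiv.Perm.mclosure_swap_castSucc_succ]; trivial
    induction hσ using Submonoid.closure_induction with
    | mem x hx =>
      obtain ⟨i, rfl⟩ := hx
      intro F
      exact GT_symm_aux (n+1) μ i (by omega) F
    | one => intro F; rfl
    | mul x y _ _ hx hy =>
      intro F
      rw [← hy F]
      exact hx (fun v => F (fun i => v (y i)))

/-- generalized alternant -/
noncomputable def alt (n : ℕ) (α : Fin n → ℕ) : MvPolynomial (Fin n) ℤ :=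
  (Matrix.of fun i j : Fin n => (X i : MvPolynomial (Fin n) ℤ) ^ α j).det

theorem alternant_eq (n : ℕ) (l : ℕ → ℕ) :
    alternant n l = alt n fun j => l j + (n - 1 - j) := rfl

theorem vandermondeP_eq (n : ℕ) : vandermondeP n = alternant n fun _ => 0 := by
  simp [vandermondeP, alternant]

theorem alt_eq_sum (n : ℕ) (α : Fin n → ℕ) :
    alt n α = ∑ σ : Equiv.Perm (Fin n), ((Equiv.Perm.sign σ : ℤ) : MvPolynomial (Fin n) ℤ) *
      ∏ i, (X (σ i) : MvPolynomial (Fin n) ℤ) ^ α i := by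
  rw [alt, Matrix.det_apply']
  simp

theorem alt_swap (n : ℕ) (α : Fin n → ℕ) (i j : Fin n) (h : i ≠ j) :
    alt n (fun k => α (Equiv.swap i j k)) = - alt n α := by
  have := Matrix.det_permute' (Equiv.swap i j)
    (Matrix.of fun i j : Fin n => (X i : MvPolynomial (Fin n) ℤ) ^ α j)
  rw [Equiv.Perm.sign_swap h] at this
  simp only [Units.val_neg, Units.val_one, Int.cast_neg, Int.cast_one, neg_mul, one_mul] at this
  rw [alt, alt, ← this]
  rfl

/-- tableau generating function -/
noncomputable def tab (n : ℕ) (μ : ℕ → ℕ) : MvPolynomial (Fin n) ℤ :=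
  ∑ g ∈ GT n μ, ∏ i : Fin n, (X i : MvPolynomial (Fin n) ℤ) ^ wt n g i

theorem alt_mul_tab (n : ℕ) (μ : ℕ → ℕ) (α : Fin n → ℕ) :
    alt n α * tab n μ = ∑ g ∈ GT n μ, alt n fun i => α i + wt n g i := by
  simp only [alt_eq_sum]
  rw [Finset.sum_comm, Finset.sum_mul]
  refine Finset.sum_congr rfl fun σ _ => ?_
  rw [mul_assoc, ← Finset.mul_sum]
  congr 1
  have := GT_symm n μ σ (fun v => ∏ i : Fin n, (X (σ i) : MvPolynomial (Fin n) ℤ) ^ (α i + v i))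
  rw [← this, tab, Finset.mul_sum]
  refine Finset.sum_congr rfl fun g _ => ?_
  simp only [pow_add, Finset.prod_mul_distrib]
  congr 1
  exact (Equiv.prod_comp σ fun i => (X i : MvPolynomial (Fin n) ℤ) ^ wt n g i).symm

theorem sum_good (n : ℕ) (l μ : ℕ → ℕ) (hl : Antitone l) :
    alternant n l * tab n μ =
      ∑ g ∈ (GT n μ).filter (Good n l), alternant n fun i => l i + wt n g i := by
  rw [alternant_eq, alt_mul_tab, ← Finset.sum_filter_add_sum_filter_not _ (Good n l)]
  have hbad : ∀ g ∈ (GT n μ).filter (fun g => ¬ Good n l g), ∃ ck : ℕ × ℕ,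
      IsMaxBad n l g ck.1 ck.2 := by
    intro g hg
    rw [Finset.mem_filter, mem_GT] at hg
    obtain ⟨c, k, h⟩ := exists_isMaxBad hl hg.1 hg.2
    exact ⟨(c, k), h⟩
  choose! f hf using hbad
  have hgt : ∀ g ∈ (GT n μ).filter (fun g => ¬ Good n l g), IsGT n μ g := by
    intro g hg
    rw [Finset.mem_filter, mem_GT] at hg
    exact hg.1
  have hmem : ∀ g ∈ (GT n μ).filter (fun g => ¬ Good n l g),
      toggle (f g).1 (f g).2 g ∈ (GT n μ).filter (fun g => ¬ Good n l g) := by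
    intro g hg
    rw [Finset.mem_filter, mem_GT]
    refine ⟨toggle_isGT (hgt g hg) _ _ (hf g hg).1.1, fun hG => ?_⟩
    exact hG _ _ ((hf g hg).toggle (hgt g hg)).1
  have hneg : ∀ g ∈ (GT n μ).filter (fun g => ¬ Good n l g),
      (alt n fun i => l i + (n - 1 - i) + wt n (toggle (f g).1 (f g).2 g) i) =
      - alt n fun i => l i + (n - 1 - i) + wt n g i := by
    intro g hg
    have hk := (hf g hg).1.1
    have := (hf g hg).wt (hgt g hg) hk
    simp only [this]
    exact alt_swap n (fun j : Fin n => l j + (n - 1 - j) + wt n g j) ⟨(f g).2, by omega⟩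
      ⟨(f g).2 + 1, hk⟩ (by simp)
  have h0 : ∑ g ∈ (GT n μ).filter (fun g => ¬ Good n l g),
      (alt n fun i => l i + (n - 1 - i) + wt n g i) = 0 := by
    refine Finset.sum_involution (fun g _ => toggle (f g).1 (f g).2 g) ?_ ?_ hmem ?_
    · intro g hg
      rw [hneg g hg, add_neg_cancel]
    · intro g hg hne he
      have := hneg g hg
      rw [he] at this
      exact hne (self_eq_neg.1 this)
    · intro g hg
      have h1 := ((hf g hg).toggle (hgt g hg)).unique (hf _ (hmem g hg))
      show toggle (f (toggle (f g).1 (f g).2 g)).1 (f (toggle (f g).1 (f g).2 g)).2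
        (toggle (f g).1 (f g).2 g) = g
      rw [← h1.1, ← h1.2]
      exact toggle_toggle (hgt g hg) _ _ (hf g hg).1.1
  rw [h0, add_zero]
  refine Finset.sum_congr rfl fun g _ => ?_
  rw [alternant_eq]
  congr 1
  funext i
  omega

/-- The Yamanouchi pattern. -/
def yam (μ : ℕ → ℕ) : ℕ → ℕ → ℕ := fun k r => if r < k then μ r else 0

theorem yam_isGT (n : ℕ) (μ : ℕ → ℕ) (hμ : Antitone μ) (h0 : ∀ i, n ≤ i → μ i = 0) :
    IsGT n μ (yam μ) := by
  constructor
  · intro r; simp [yam]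
  · intro k r; simp only [yam]; split_ifs <;> omega
  · intro k r
    have := hμ (show r ≤ r + 1 by omega)
    simp only [yam]; split_ifs <;> omega
  · intro k hk
    funext r
    simp only [yam]
    split_ifs with h
    · rfl
    · exact (h0 r (by omega)).symm

theorem sum_yam (n k : ℕ) (hk : k < n) (f : ℕ → ℕ) :
    (∑ r ∈ Finset.range n, if r < k + 1 then f r else 0) =
      (∑ r ∈ Finset.range n, if r < k then f r else 0) + f k := by
  have : f k = ∑ r ∈ Finset.range n, if r = k then f r else 0 := by
    simp [hk]
  rw [this, ← Finset.sum_add_distrib]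
  refine Finset.sum_congr rfl fun r _ => ?_
  split_ifs <;> omega

theorem yam_XS (n : ℕ) (μ : ℕ → ℕ) (c k : ℕ) (hk : k < n) :
    XS n (yam μ) c (k+1) = XS n (yam μ) c k + (μ k - c) := by
  have := sum_yam n k hk (fun r => μ r - c)
  simp only [XS, yam, ite_sub, zero_tsub]
  simpa using this

theorem yam_wt (n : ℕ) (μ : ℕ → ℕ) (k : ℕ) (hk : k < n) : wt n (yam μ) k = μ k := by
  have := sum_yam n k hk μ
  simp only [wt, SS, yam]
  omega

theorem yam_good (n : ℕ) (μ : ℕ → ℕ) (hμ : Antitone μ) : Good n (fun _ => 0) (yam μ) := by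
  rintro c k ⟨hk, h⟩
  have h1 := yam_XS n μ c k (by omega)
  have h2 := yam_XS n μ c (k+1) hk
  have := hμ (show k ≤ k + 1 by omega)
  have n5 : k + 1 + 1 = k + 2 := rfl
  rw [n5] at h2
  simp only at h
  omega

theorem good_row {n : ℕ} {μ : ℕ → ℕ} {g : ℕ → ℕ → ℕ} (h : IsGT n μ g)
    (hg : Good n (fun _ => 0) g) (r : ℕ) : g (r+1) r = μ r := by
  induction r using Nat.strong_induction_on with
  | _ r ih =>
  by_contra hne
  have hlt : g (r+1) r < μ r := lt_of_le_of_ne (h.le_top _ _) hne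
  have hex : ∃ k, g (r+1) r < g (k+1) r :=
    ⟨n, by rw [h.top (n+1) (by omega)]; exact hlt⟩
  have hk1 := Nat.find_spec hex
  have hk2 := fun m => Nat.find_min hex (m := m)
  generalize Nat.find hex = k at hk1 hk2
  have hrk : r + 1 ≤ k := by
    by_contra hcon
    have := h.mono r (show k + 1 ≤ r + 1 by omega)
    simp only at this
    omega
  obtain ⟨j, rfl⟩ : ∃ j, k = j + 1 := ⟨k - 1, by omega⟩
  have hkr : g (j+1) r = g (r+1) r := by
    have := hk2 j (by omega)
    have h2 := h.mono r hrk
    simp only at h2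
    omega
  have hkn : j + 1 < n := by
    by_contra hcon
    rw [h.top (j+1) (by omega)] at hkr
    omega
  refine hg (g (r+1) r) j ⟨hkn, ?_⟩
  have e1 : XS n g (g (r+1) r) (j+1) = XS n g (g (r+1) r) j := by
    refine Finset.sum_congr rfl fun r' _ => ?_
    by_cases hr' : r' < r
    · have a := ih r' hr'
      have b := h.mono r' (show r' + 1 ≤ j by omega)
      have b2 := h.le j r'
      have b3 := h.le_top (j+1) r'
      simp only at b
      have : g (j+1) r' = g j r' := by omega
      rw [this]
    · have a := h.anti (j+1) (show r ≤ r' by omega)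
      have b := h.le j r'
      omega
  have e2 : XS n g (g (r+1) r) (j+1) < XS n g (g (r+1) r) (j+2) := by
    refine Finset.sum_lt_sum (fun r' _ => ?_) ⟨r, Finset.mem_range.2 (by omega), ?_⟩
    · have : g (j+1) r' ≤ g (j+2) r' := h.le (j+1) r'
      omega
    · have : g (r+1) r < g (j+2) r := hk1
      omega
  simp only
  omega

theorem good_eq_yam {n : ℕ} {μ : ℕ → ℕ} {g : ℕ → ℕ → ℕ} (h : IsGT n μ g)
    (hg : Good n (fun _ => 0) g) : g = yam μ := by
  funext k r
  simp only [yam]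
  split_ifs with hr
  · have a := good_row h hg r
    have b := h.mono r (show r + 1 ≤ k by omega)
    have c := h.le_top k r
    simp only at b
    omega
  · exact h.eq_zero k r (by omega)

theorem tab_mul_vandermonde (n : ℕ) (μ : ℕ → ℕ) (hμ : Antitone μ) (h0 : ∀ i, n ≤ i → μ i = 0) :
    tab n μ * vandermondeP n = alternant n μ := by
  rw [mul_comm, vandermondeP_eq, sum_good n _ μ (fun _ _ _ => le_rfl)]
  have : (GT n μ).filter (Good n fun _ => 0) = {yam μ} := by
    ext g
    rw [Finset.mem_filter, mem_GT, Finset.mem_singleton]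
    constructor
    · rintro ⟨h1, h2⟩; exact good_eq_yam h1 h2
    · rintro rfl; exact ⟨yam_isGT n μ hμ h0, yam_good n μ hμ⟩
  rw [this, Finset.sum_singleton, alternant_eq, alternant_eq]
  congr 1
  funext i
  rw [yam_wt n μ i i.2, zero_add]

theorem coeff_alt (n : ℕ) (α β : Fin n → ℕ) (hα : StrictAnti α) (hβ : StrictAnti β) :
    coeff (Finsupp.equivFunOnFinite.symm β) (alt n α) = if α = β then 1 else 0 := by
  have hterm : ∀ σ : Equiv.Perm (Fin n),
      ((Equiv.Perm.sign σ : ℤ) : MvPolynomial (Fin n) ℤ) *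
      ∏ i, (X (σ i) : MvPolynomial (Fin n) ℤ) ^ α i =
      monomial (Finsupp.equivFunOnFinite.symm fun i => α (σ⁻¹ i)) (Equiv.Perm.sign σ : ℤ) := by
    intro σ
    rw [monomial_eq, Finsupp.prod_fintype _ _ (by simp)]
    congr 1
    rw [← Equiv.prod_comp σ (fun x => (X x : MvPolynomial (Fin n) ℤ) ^ _)]
    simp
  have hone : ∀ σ : Equiv.Perm (Fin n), (fun i => α (σ⁻¹ i)) = β → σ = 1 := by
    intro σ h
    have hs : StrictMono (σ⁻¹ : Equiv.Perm (Fin n)) := by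
      intro i j hij
      by_contra hcon
      have h1 : α (σ⁻¹ i) ≤ α (σ⁻¹ j) := hα.antitone (not_lt.1 hcon)
      have h2 := hβ hij
      rw [← h] at h2
      simp only at h2
      omega
    have h3 := Subsingleton.elim (hs.orderIsoOfSurjective _ (σ⁻¹ : Equiv.Perm (Fin n)).surjective) (OrderIso.refl _)
    have h4 : σ⁻¹ = 1 := by
      ext i
      have := congrArg (fun e : Fin n ≃o Fin n => ((e i : Fin n) : ℕ)) h3
      simpa using this
    exact inv_eq_one.1 h4
  rw [alt_eq_sum, coeff_sum]
  simp only [hterm, coeff_monomial, EmbeddingLike.apply_eq_iff_eq]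
  rw [Finset.sum_eq_single 1]
  · simp
  · intro σ _ hσ
    rw [if_neg fun h => hσ (hone σ h)]
  · simp

theorem strictAnti_rho (n : ℕ) (l : ℕ → ℕ) (hl : Antitone l) :
    StrictAnti fun j : Fin n => l j + (n - 1 - j) := by
  intro i j hij
  have h1 : (i : ℕ) < j := hij
  have h2 := hl h1.le
  have := j.2
  simp only
  omega

theorem vandermondeP_ne_zero (n : ℕ) : vandermondeP n ≠ 0 := by
  intro h
  have hs := strictAnti_rho n (fun _ => 0) (fun _ _ _ => le_rfl)
  have := coeff_alt n _ _ hs hs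
  rw [← alternant_eq n (fun _ => 0), ← vandermondeP_eq, h] at this
  simp at this

theorem Partn.anti (p : Partn) : Antitone p.parts := fun i j h => p.antitone i j h

theorem schur_mul (n : ℕ) (p : Partn) (hp : p.LengthLE n) :
    schur n p.parts * vandermondeP n = alternant n p.parts := by
  have h : ∃ q : MvPolynomial (Fin n) ℤ, q * vandermondeP n = alternant n p.parts :=
    ⟨_, tab_mul_vandermonde n p.parts p.anti hp⟩
  rw [schur, dif_pos h]
  exact h.choose_spec

theorem schur_eq_tab (n : ℕ) (p : Partn) (hp : p.LengthLE n) :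
    schur n p.parts = tab n p.parts := by
  apply mul_right_cancel₀ (vandermondeP_ne_zero n)
  rw [schur_mul n p hp, tab_mul_vandermonde n p.parts p.anti hp]

theorem Partn.ext' {p q : Partn} (h : p.parts = q.parts) : p = q := by
  cases p; cases q; simp_all

theorem weight_eq (n : ℕ) (p : Partn) (hp : p.LengthLE n) :
    p.weight = ∑ r ∈ Finset.range n, p.parts r := by
  rw [Partn.weight]
  refine finsum_eq_sum_of_support_subset _ ?_
  intro i hi
  by_contra hcon
  exact hi (hp i (by simpa using hcon))

theorem finite_partn (n w : ℕ) : {ν : Partn | ν.weight = w ∧ ν.LengthLE n}.Finite := by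
  refine Set.Finite.of_injOn (f := fun ν (k : Fin n) => ν.parts k)
    (t := Set.Iic (fun _ => w)) ?_ ?_ (Set.finite_Iic _)
  · rintro p ⟨h1, h2⟩ k
    rw [weight_eq n p h2] at h1
    rw [← h1]
    exact Finset.single_le_sum (f := p.parts) (fun _ _ => Nat.zero_le _) (Finset.mem_range.2 k.2)
  · rintro p ⟨_, h1⟩ q ⟨_, h2⟩ he
    apply Partn.ext'
    funext k
    by_cases hk : k < n
    · exact congrFun he ⟨k, hk⟩
    · rw [h1 k (by omega), h2 k (by omega)]

theorem sum_wt {n : ℕ} {μ : ℕ → ℕ} {g : ℕ → ℕ → ℕ} (h : IsGT n μ g) :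
    ∑ r ∈ Finset.range n, wt n g r = ∑ r ∈ Finset.range n, μ r := by
  have hm : Monotone (SS n g) := monotone_nat_of_le_succ (SS_mono h)
  simp only [wt]
  rw [Finset.sum_range_tsub hm]
  simp [SS, h.zero, h.top n le_rfl]

theorem good_anti {n : ℕ} {l μ : ℕ → ℕ} {g : ℕ → ℕ → ℕ} (h : IsGT n μ g) (hg : Good n l g)
    (k : ℕ) (hk : k + 1 < n) : l (k+1) + wt n g (k+1) ≤ l k + wt n g k := by
  have h1 := hg 0 k
  simp only [BadAt, hk, true_and, not_lt, XS, tsub_zero] at h1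
  have m1 := SS_mono h k
  have m2 := SS_mono h (k+1)
  simp only [wt, SS] at *
  have n5 : k + 1 + 1 = k + 2 := rfl
  rw [n5] at *
  omega

theorem exists_partn {n : ℕ} {l m : Partn} (hl : l.LengthLE n) (hm : m.LengthLE n)
    {g : ℕ → ℕ → ℕ} (h : IsGT n m.parts g) (hg : Good n l.parts g) :
    ∃ ν : Partn, (ν.weight = l.weight + m.weight ∧ ν.LengthLE n) ∧
      ∀ i < n, ν.parts i = l.parts i + wt n g i := by
  have hlen : ∀ i, n ≤ i → (if i < n then l.parts i + wt n g i else 0) = 0 := by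
    intro i hi
    rw [if_neg (by omega)]
  let ν : Partn :=
    { parts := fun i => if i < n then l.parts i + wt n g i else 0
      antitone := by
        apply antitone_nat_of_succ_le
        intro k
        split_ifs with h1 h2
        · exact good_anti h hg k h1
        · omega
        · omega
        · omega
      eventually_zero := ⟨n, hlen⟩ }
  refine ⟨ν, ⟨?_, hlen⟩, fun i hi => if_pos hi⟩
  rw [weight_eq n ν hlen, weight_eq n l hl, weight_eq n m hm, ← sum_wt h,
    ← Finset.sum_add_distrib]
  exact Finset.sum_congr rfl fun r hr => if_pos (Finset.mem_range.1 hr)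

theorem alternant_congr {n : ℕ} {l l' : ℕ → ℕ} (h : ∀ i < n, l i = l' i) :
    alternant n l = alternant n l' := by
  rw [alternant_eq, alternant_eq]
  congr 1
  funext i
  rw [h i i.2]

theorem coeff_alternant (n : ℕ) (p q : Partn) (hp : p.LengthLE n) (hq : q.LengthLE n) :
    coeff (Finsupp.equivFunOnFinite.symm fun j : Fin n => q.parts j + (n - 1 - j))
      (alternant n p.parts) = if p = q then 1 else 0 := by
  rw [alternant_eq, coeff_alt n _ _ (strictAnti_rho n _ p.anti) (strictAnti_rho n _ q.anti)]
  congr 1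
  apply propext
  constructor
  · intro h
    apply Partn.ext'
    funext i
    by_cases hi : i < n
    · have := congrFun h ⟨i, hi⟩
      simp only at this
      omega
    · rw [hp i (by omega), hq i (by omega)]
  · rintro rfl; rfl

theorem schur_product_expansion (n : ℕ) (l m : Partn)
    (hl : l.LengthLE n) (hm : m.LengthLE n) :
    ∃ c : Partn → ℤ,
      (∀ ν : Partn, ¬(ν.weight = l.weight + m.weight ∧ ν.LengthLE n) → c ν = 0) ∧
      schur n l.parts * schur n m.parts = (∑ᶠ ν : Partn, c ν • schur n ν.parts) ∧
      (∀ ν : Partn, 0 ≤ c ν) ∧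
      ∀ c' : Partn → ℤ,
        (∀ ν : Partn, ¬(ν.weight = l.weight + m.weight ∧ ν.LengthLE n) → c' ν = 0) →
        schur n l.parts * schur n m.parts = (∑ᶠ ν : Partn, c' ν • schur n ν.parts) →
        c' = c := by
  have hfin := finite_partn n (l.weight + m.weight)
  -- any admissible expansion, multiplied by the Vandermonde determinant
  have hexp : ∀ c : Partn → ℤ,
      (∀ ν : Partn, ¬(ν.weight = l.weight + m.weight ∧ ν.LengthLE n) → c ν = 0) →
      (∑ᶠ ν : Partn, c ν • schur n ν.parts) * vandermondeP n =
        ∑ ν ∈ hfin.toFinset, c ν • alternant n ν.parts := by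
    intro c hc
    rw [finsum_eq_sum_of_support_subset (s := hfin.toFinset) _ ?_, Finset.sum_mul]
    · refine Finset.sum_congr rfl fun ν hν => ?_
      rw [smul_mul_assoc, schur_mul n ν]
      simp only [Set.Finite.mem_toFinset, Set.mem_ofPred_eq] at hν
      exact hν.2
    · intro ν hν
      simp only [Set.Finite.coe_toFinset, Set.mem_ofPred_eq]
      by_contra hcon
      apply hν
      simp only [hc ν hcon, zero_smul]
  have hcoef : ∀ c : Partn → ℤ,
      (∀ ν : Partn, ¬(ν.weight = l.weight + m.weight ∧ ν.LengthLE n) → c ν = 0) →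
      schur n l.parts * schur n m.parts = (∑ᶠ ν : Partn, c ν • schur n ν.parts) →
      ∀ ν : Partn, (ν.weight = l.weight + m.weight ∧ ν.LengthLE n) → c ν =
        coeff (Finsupp.equivFunOnFinite.symm fun j : Fin n => ν.parts j + (n - 1 - j))
          (schur n l.parts * schur n m.parts * vandermondeP n) := by
    intro c hc he ν hν
    rw [he, hexp c hc, coeff_sum, Finset.sum_eq_single ν]
    · rw [coeff_smul, coeff_alternant n ν ν hν.2 hν.2]; simp
    · intro p hp hne
      simp only [Set.Finite.mem_toFinset, Set.mem_ofPred_eq] at hp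
      rw [coeff_smul, coeff_alternant n p ν hp.2 hν.2, if_neg hne, smul_zero]
    · intro h
      exact absurd (by simpa using hν) h
  have hpart : ∀ g ∈ (GT n m.parts).filter (Good n l.parts),
      ∃ ν : Partn, (ν.weight = l.weight + m.weight ∧ ν.LengthLE n) ∧
        ∀ i < n, ν.parts i = l.parts i + wt n g i := by
    intro g hg
    rw [Finset.mem_filter, mem_GT] at hg
    exact exists_partn hl hm hg.1 hg.2
  have : Nonempty Partn := ⟨l⟩
  choose! φ hφ1 hφ2 using hpart
  let c : Partn → ℤ := fun ν =>
    ((((GT n m.parts).filter (Good n l.parts)).filter fun g => φ g = ν).card : ℤ)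
  have hc0 : ∀ ν : Partn, ¬(ν.weight = l.weight + m.weight ∧ ν.LengthLE n) → c ν = 0 := by
    intro ν hν
    simp only [c, Nat.cast_eq_zero, Finset.card_eq_zero]
    rw [Finset.filter_eq_empty_iff]
    intro g hg he
    exact hν (he ▸ hφ1 g hg)
  have hce : schur n l.parts * schur n m.parts = (∑ᶠ ν : Partn, c ν • schur n ν.parts) := by
    apply mul_right_cancel₀ (vandermondeP_ne_zero n)
    rw [hexp c hc0, mul_right_comm, schur_mul n l hl, schur_eq_tab n m hm,
      sum_good n l.parts m.parts l.anti]
    rw [← Finset.sum_fiberwise_of_maps_to (g := φ) (t := hfin.toFinset)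
      (fun g hg => by simpa using hφ1 g hg)]
    refine Finset.sum_congr rfl fun ν _ => ?_
    rw [Finset.sum_congr rfl (g := fun _ => alternant n ν.parts)]
    · rw [Finset.sum_const]
      simp [c]
    · intro g hg
      rw [Finset.mem_filter] at hg
      apply alternant_congr
      intro i hi
      rw [← hg.2, hφ2 g hg.1 i hi]
  refine ⟨c, hc0, hce, fun ν => by simp [c], ?_⟩
  intro c' hc' he'
  funext ν
  by_cases hν : ν.weight = l.weight + m.weight ∧ ν.LengthLE n
  · rw [hcoef c' hc' he' ν hν, hcoef c hc0 hce ν hν]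
  · rw [hc' ν hν, hc0 ν hν]
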